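/- Let F and Q be exchangeable information structures on S^N with identical, strictly positive marginals. Then F is sCAD-higher than Q if and only if E(Γ,F) ⊇ E(Γ,Q) for every private-value coordination game Γ (i.e., every game with β ≥ 0 and h nondecreasing). -/

import Mathlib

open Finset

def IsPMF {n : ℕ} {S : Type*} [Fintype S] (F : (Fin (n + 2) → S) → ℝ) : Prop :=
  (∀ t, 0 ≤ F t) ∧ ∑ t : Fin (n + 2) → S, F t = 1

def Exchangeable {n : ℕ} {S : Type*} [Fintype S] (F : (Fin (n + 2) → S) → ℝ) : Prop :=
  ∀ (π : Equiv.Perm (Fin (n + 2))) (t : Fin (n + 2) → S), F (t ∘ π) = F t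

noncomputable def marg {n : ℕ} {S : Type*} [Fintype S] [DecidableEq S]
    (F : (Fin (n + 2) → S) → ℝ) (s : S) : ℝ :=
  ∑ t : Fin (n + 2) → S, if t 0 = s then F t else 0

/-- `C_K(t)`: the number of players other than player `0` whose signal lies in `K`. -/
def countIn {n : ℕ} {S : Type*} [Fintype S] [DecidableEq S]
    (K : Finset S) (t : Fin (n + 2) → S) : ℕ :=
  (univ.filter (fun j : Fin (n + 2) => j ≠ 0 ∧ t j ∈ K)).card

/-- `P_F(C_K ≥ m | t_0 = s)`. -/
noncomputable def tailProb {n : ℕ} {S : Type*} [Fintype S] [DecidableEq S]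
    (F : (Fin (n + 2) → S) → ℝ) (s : S) (K : Finset S) (m : ℕ) : ℝ :=
  (∑ t : Fin (n + 2) → S, if t 0 = s ∧ m ≤ countIn K t then F t else 0) / marg F s

/-- `F` is sCAD-higher than `Q`: conditional on any own signal `s`, the number of
other players with signal in any `K ∋ s` is larger in first-order stochastic
dominance. Here `N - 1 = n + 1`. -/
def sCAD {n : ℕ} {S : Type*} [Fintype S] [DecidableEq S]
    (F Q : (Fin (n + 2) → S) → ℝ) : Prop :=
  (∀ s, marg F s = marg Q s) ∧
  ∀ (s : S) (K : Finset S), s ∈ K → ∀ m : ℕ, m ≤ n + 1 →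
    tailProb F s K m ≥ tailProb Q s K m

/-- A private-value coordination game: `d(A,s) = α(s) + β(s)·h(A)` with `β ≥ 0`
and `h` nondecreasing. -/
structure PVGame (S : Type*) where
  α : S → ℝ
  β : S → ℝ
  h : ℕ → ℝ
  hβ : ∀ s, 0 ≤ β s
  hmono : ∀ a b : ℕ, a ≤ b → h a ≤ h b

noncomputable def payoff {S : Type*} (G : PVGame S) (A : ℕ) (s : S) : ℝ :=
  G.α s + G.β s * G.h A

def acts {n : ℕ} {S : Type*} (σ : S → Bool) (t : Fin (n + 2) → S) : ℕ :=
  (univ.filter (fun j : Fin (n + 2) => j ≠ 0 ∧ σ (t j) = true)).card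

noncomputable def U {n : ℕ} {S : Type*} [Fintype S] [DecidableEq S]
    (G : PVGame S) (F : (Fin (n + 2) → S) → ℝ) (σ : S → Bool) (s : S) : ℝ :=
  (∑ t : Fin (n + 2) → S, if t 0 = s then F t * payoff G (acts σ t) s else 0) / marg F s

def IsEquilibrium {n : ℕ} {S : Type*} [Fintype S] [DecidableEq S]
    (G : PVGame S) (F : (Fin (n + 2) → S) → ℝ) (σ : S → Bool) : Prop :=
  ∀ s : S, (σ s = true → 0 ≤ U G F σ s) ∧ (σ s = false → U G F σ s ≤ 0)

lemma PVGame.payoff_mono {S : Type*} (G : PVGame S) (s : S) : Monotone fun A => payoff G A s :=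
  fun a b hab => add_le_add_right (mul_le_mul_of_nonneg_left (G.hmono a b hab) (G.hβ s)) _

section SCADHelpers

variable {n : ℕ} {S : Type*} [Fintype S] [DecidableEq S]

/-- Expectation of `g (C_K)` conditional on the own signal `s`. -/
noncomputable def condExpCount (F : (Fin (n + 2) → S) → ℝ) (s : S) (K : Finset S)
    (g : ℕ → ℝ) : ℝ :=
  (∑ t : Fin (n + 2) → S, if t 0 = s then F t * g (countIn K t) else 0) / marg F s

lemma acts_eq_countIn (σ : S → Bool) (t : Fin (n + 2) → S) :
    acts σ t = countIn (univ.filter fun s => σ s = true) t := by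
  simp [acts, countIn]

lemma countIn_add_countIn_compl (K : Finset S) (t : Fin (n + 2) → S) :
    countIn K t + countIn Kᶜ t = n + 1 := by
  have h := card_filter_add_card_filter_not (s := univ.filter fun j : Fin (n + 2) => j ≠ 0)
    (fun j => t j ∈ K)
  rw [filter_filter, filter_filter, filter_ne' univ, card_erase_of_mem (mem_univ _),
    card_univ, Fintype.card_fin] at h
  simpa [countIn] using h

lemma U_eq_condExpCount (G : PVGame S) (F : (Fin (n + 2) → S) → ℝ) (σ : S → Bool) (s : S) :
    U G F σ s =
      condExpCount F s (univ.filter fun s => σ s = true) (fun A => payoff G A s) := by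
  simp only [U, condExpCount, acts_eq_countIn]

lemma condExpCount_const {F : (Fin (n + 2) → S) → ℝ} {s : S} (hF : marg F s ≠ 0)
    (K : Finset S) (c : ℝ) : condExpCount F s K (fun _ => c) = c := by
  rw [condExpCount, div_eq_iff hF, marg, mul_sum]
  exact sum_congr rfl fun t _ => by split_ifs <;> ring

lemma condExpCount_add (F : (Fin (n + 2) → S) → ℝ) (s : S) (K : Finset S) (f g : ℕ → ℝ) :
    condExpCount F s K (fun A => f A + g A) = condExpCount F s K f + condExpCount F s K g := by
  rw [condExpCount, condExpCount, condExpCount, ← add_div, ← sum_add_distrib]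
  congr 1
  exact sum_congr rfl fun t _ => by split_ifs <;> ring

lemma condExpCount_mul (F : (Fin (n + 2) → S) → ℝ) (s : S) (K : Finset S) (c : ℝ)
    (g : ℕ → ℝ) : condExpCount F s K (fun A => c * g A) = c * condExpCount F s K g := by
  rw [condExpCount, condExpCount, ← mul_div_assoc, mul_sum]
  congr 1
  exact sum_congr rfl fun t _ => by split_ifs <;> ring

lemma condExpCount_sum (F : (Fin (n + 2) → S) → ℝ) (s : S) (K : Finset S) {ι : Type*}
    (I : Finset ι) (g : ι → ℕ → ℝ) :
    condExpCount F s K (fun A => ∑ i ∈ I, g i A) = ∑ i ∈ I, condExpCount F s K (g i) := by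
  simp only [condExpCount]
  rw [← sum_div, sum_comm]
  congr 1
  exact sum_congr rfl fun t _ => by split_ifs <;> simp [mul_sum]

lemma condExpCount_indicator (F : (Fin (n + 2) → S) → ℝ) (s : S) (K : Finset S) (m : ℕ) :
    condExpCount F s K (fun A => if m ≤ A then 1 else 0) = tailProb F s K m := by
  rw [condExpCount, tailProb]
  congr 1
  exact sum_congr rfl fun t _ => by simp [ite_and]

lemma eq_add_sum_increments (g : ℕ → ℝ) {A M : ℕ} (hA : A ≤ M) :
    g A = g 0 + ∑ i ∈ range M, (g (i + 1) - g i) * (if i + 1 ≤ A then 1 else 0) := by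
  have hfilter : (range M).filter (fun i => i + 1 ≤ A) = range A := by
    ext i
    simp only [mem_filter, mem_range]
    omega
  simp only [mul_ite, mul_one, mul_zero]
  rw [← sum_filter, hfilter, sum_range_sub]
  ring

lemma condExpCount_congr (F : (Fin (n + 2) → S) → ℝ) (s : S) (K L : Finset S) {f g : ℕ → ℝ}
    (h : ∀ t : Fin (n + 2) → S, f (countIn K t) = g (countIn L t)) :
    condExpCount F s K f = condExpCount F s L g := by
  simp only [condExpCount, h]

/-- Layer-cake formula for conditional expectations of functions of `C_K`. -/
lemma condExpCount_eq_sum_tailProb {F : (Fin (n + 2) → S) → ℝ} {s : S} (hF : marg F s ≠ 0)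
    (K : Finset S) (g : ℕ → ℝ) :
    condExpCount F s K g =
      g 0 + ∑ i ∈ range (n + 1), (g (i + 1) - g i) * tailProb F s K (i + 1) := by
  rw [condExpCount_congr F s K K (g := fun A => g 0 +
      ∑ i ∈ range (n + 1), (g (i + 1) - g i) * (if i + 1 ≤ A then 1 else 0))
      (fun t => eq_add_sum_increments g
      ((Nat.le_add_right _ _).trans (countIn_add_countIn_compl K t).le)),
    condExpCount_add F s K (fun _ => g 0), condExpCount_const hF, condExpCount_sum]
  simp only [condExpCount_mul, condExpCount_indicator]

lemma sCAD.condExpCount_le {F Q : (Fin (n + 2) → S) → ℝ} (h : sCAD F Q) {s : S}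
    (hF : marg F s ≠ 0) {K : Finset S} (hs : s ∈ K) {g : ℕ → ℝ} (hg : Monotone g) :
    condExpCount Q s K g ≤ condExpCount F s K g := by
  rw [condExpCount_eq_sum_tailProb hF, condExpCount_eq_sum_tailProb (h.1 s ▸ hF)]
  gcongr with i hi
  · exact sub_nonneg.2 (hg i.le_succ)
  · exact h.2 s K hs _ (mem_range.1 hi)

lemma sCAD.condExpCount_ge_of_notMem {F Q : (Fin (n + 2) → S) → ℝ} (h : sCAD F Q) {s : S}
    (hF : marg F s ≠ 0) {K : Finset S} (hs : s ∉ K) {g : ℕ → ℝ} (hg : Monotone g) :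
    condExpCount F s K g ≤ condExpCount Q s K g := by
  have reflect : ∀ P : (Fin (n + 2) → S) → ℝ,
      condExpCount P s K (fun A => -1 * g A) =
        condExpCount P s Kᶜ (fun A => -g (n + 1 - A)) := fun P =>
    condExpCount_congr P s K Kᶜ fun t => by
      rw [← countIn_add_countIn_compl K t, Nat.add_sub_cancel, neg_one_mul]
  have key := h.condExpCount_le hF (mem_compl.2 hs) (g := fun A => -g (n + 1 - A))
    fun a b hab => neg_le_neg (hg (Nat.sub_le_sub_left hab _))
  rw [← reflect, ← reflect, condExpCount_mul, condExpCount_mul] at key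
  linarith

/-- The game with unit benefit from at least `m` other players acting and intercept `α`. -/
def thresholdGame (α : S → ℝ) (m : ℕ) : PVGame S where
  α := α
  β _ := 1
  h A := if m ≤ A then 1 else 0
  hβ _ := zero_le_one
  hmono a b hab := by
    split_ifs with h₁ h₂
    · exact le_rfl
    · exact absurd (h₁.trans hab) h₂
    · exact zero_le_one
    · exact le_rfl

lemma U_thresholdGame {F : (Fin (n + 2) → S) → ℝ} {s : S} (hF : marg F s ≠ 0)
    (α : S → ℝ) (m : ℕ) (K : Finset S) :
    U (thresholdGame α m) F (fun s => decide (s ∈ K)) s = α s + tailProb F s K m := by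
  rw [U_eq_condExpCount]
  simp only [payoff, thresholdGame, one_mul, decide_eq_true_eq, filter_univ_mem]
  rw [condExpCount_add F s K (fun _ => α s), condExpCount_const hF, condExpCount_indicator]

end SCADHelpers

/-- `F ⪰sCAD Q` iff the equilibrium set weakly expands from `Q` to `F`
in every private-value coordination game (β ≥ 0, h nondecreasing). -/
theorem scad_iff_equilibrium_inclusion {n : ℕ}
    {S : Type*} [Fintype S] [DecidableEq S] [Nonempty S]
    (F Q : (Fin (n + 2) → S) → ℝ)
    (hFpmf : IsPMF F) (hQpmf : IsPMF Q)
    (hFex : Exchangeable F) (hQex : Exchangeable Q)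
    (hmarg : ∀ s, marg F s = marg Q s)
    (hpos : ∀ s, 0 < marg F s) :
    sCAD F Q ↔ ∀ (G : PVGame S) (σ : S → Bool),
      IsEquilibrium G Q σ → IsEquilibrium G F σ := by
  constructor
  · intro h G σ hQ s
    rw [U_eq_condExpCount]
    have hs := hQ s
    rw [U_eq_condExpCount] at hs
    refine ⟨fun hσ => (hs.1 hσ).trans ?_, fun hσ => le_trans ?_ (hs.2 hσ)⟩
    · exact h.condExpCount_le (hpos s).ne' (by simpa using hσ) (G.payoff_mono s)
    · exact h.condExpCount_ge_of_notMem (hpos s).ne' (by simpa using hσ) (G.payoff_mono s)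
  · refine fun h => ⟨hmarg, fun s K hs m _ => ?_⟩
    have hQeq : IsEquilibrium (thresholdGame (fun s' => -tailProb Q s' K m) m) Q
        (fun s' => decide (s' ∈ K)) := fun s' => by
      rw [U_thresholdGame (hmarg s' ▸ (hpos s').ne')]
      simp
    have key := (h _ _ hQeq s).1 (by simpa using hs)
    rw [U_thresholdGame (hpos s).ne'] at key
    linarith
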